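/- arXiv:1305.2403 — 3 statements merged into one kernel-verified Lean document; each statement's English description precedes it below -/
import Mathlib

section
/- For the metric g on U with parameters a ≠ 0, b ≠ 0, the Ricci tensor R_{ij} = ∂_k Γ^k_{ij} − ∂_j Γ^k_{ik} + Γ^k_{kl} Γ^l_{ij} − Γ^k_{jl} Γ^l_{ik} (summation over repeated indices, Γ the Christoffel symbols of g) equals at every point of U the matrix (1/a)·[[−6b, 6bt/r, 0, 0], [6bt/r, −2(3bt² + a)/r², 0, 0], [0, 0, a−3, 0], [0, 0, 0, (a−3) sin²θ]], and consequently the scalar curvature S = Σ_{ij}(g⁻¹)^{ij} R_{ij} equals 2(a−7)/(a r²). In particular the curvature is singular along r = 0 and S = 0 identically when a = 7. -/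
open Real

/-- The chart `U = {(t,r,θ,φ) : r > 0, 0 < θ < π}` (coordinates ordered `(t,r,θ,φ)`
as `p 0, p 1, p 2, p 3`). -/
def chartU : Set (Fin 4 → ℝ) := {p | 0 < p 1 ∧ 0 < p 2 ∧ p 2 < Real.pi}

/-- The metric matrix `g` with parameters `a, b`. -/
noncomputable def gmet (a b : ℝ) (p : Fin 4 → ℝ) : Matrix (Fin 4) (Fin 4) ℝ :=
  !![b * (p 1)^2, -(b * (p 1) * (p 0)), 0, 0;
     -(b * (p 1) * (p 0)), a + b * (p 0)^2, 0, 0;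
     0, 0, (p 1)^2, 0;
     0, 0, 0, (p 1)^2 * (Real.sin (p 2))^2]

/-- The inverse metric matrix `g⁻¹`. -/
noncomputable def ginv (a b : ℝ) (p : Fin 4 → ℝ) : Matrix (Fin 4) (Fin 4) ℝ :=
  !![(b * (p 0)^2 + a) / (a * b * (p 1)^2), (p 0) / (a * (p 1)), 0, 0;
     (p 0) / (a * (p 1)), 1 / a, 0, 0;
     0, 0, 1 / (p 1)^2, 0;
     0, 0, 0, 1 / ((p 1)^2 * (Real.sin (p 2))^2)]

/-- Partial derivative `∂_j f` of a function of the coordinates. -/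
noncomputable def pd (j : Fin 4) (f : (Fin 4 → ℝ) → ℝ) (p : Fin 4 → ℝ) : ℝ :=
  deriv (fun s => f (Function.update p j s)) (p j)

/-- Christoffel symbols `Γ^l_{jk} = ½ Σ_m (g⁻¹)^{lm}(∂_j g_{mk} + ∂_k g_{jm} − ∂_m g_{jk})`. -/
noncomputable def Gamma (a b : ℝ) (l j k : Fin 4) (p : Fin 4 → ℝ) : ℝ :=
  (1/2) * ∑ m, ginv a b p l m *
    (pd j (fun q => gmet a b q m k) p + pd k (fun q => gmet a b q j m) p
      - pd m (fun q => gmet a b q j k) p)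

/-- The Ricci tensor
`R_{ij} = ∂_k Γ^k_{ij} − ∂_j Γ^k_{ik} + Γ^k_{kl} Γ^l_{ij} − Γ^k_{jl} Γ^l_{ik}`. -/
noncomputable def RicciT (a b : ℝ) (i j : Fin 4) (p : Fin 4 → ℝ) : ℝ :=
  (∑ k, pd k (fun q => Gamma a b k i j q) p)
    - (∑ k, pd j (fun q => Gamma a b k i k q) p)
    + (∑ k, ∑ l, Gamma a b k k l p * Gamma a b l i j p)
    - (∑ k, ∑ l, Gamma a b k j l p * Gamma a b l i k p)

/-- The scalar curvature `S = Σ_{ij} (g⁻¹)^{ij} R_{ij}`. -/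
noncomputable def ScalC (a b : ℝ) (p : Fin 4 → ℝ) : ℝ :=
  ∑ i, ∑ j, ginv a b p i j * RicciT a b i j p

/-- The claimed explicit value of the Ricci tensor. -/
noncomputable def RicciVal (a b : ℝ) (p : Fin 4 → ℝ) : Matrix (Fin 4) (Fin 4) ℝ :=
  (1/a) • !![-(6*b), 6*b*(p 0)/(p 1), 0, 0;
             6*b*(p 0)/(p 1), -(2*(3*b*(p 0)^2 + a)/(p 1)^2), 0, 0;
             0, 0, a - 3, 0;
             0, 0, 0, (a - 3) * (Real.sin (p 2))^2]

lemma forall4 {P : Fin 4 → Prop} (h0 : P 0) (h1 : P 1) (h2 : P 2) (h3 : P 3) : ∀ i, P i := by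
  intro i; fin_cases i <;> assumption

/-- Closed form of the Christoffel symbols. -/
noncomputable def GV (a b : ℝ) (l : Fin 4) (q : Fin 4 → ℝ) : Matrix (Fin 4) (Fin 4) ℝ :=
  match l with
  | 0 =>
    !![-(2 * b / a) * q 0, (2 * b / a * (q 0)^2 + 1) * (q 1)⁻¹, 0, 0;
       (2 * b / a * (q 0)^2 + 1) * (q 1)⁻¹,
          (-(2 * b / a) * (q 0)^3 - 2 * q 0) * ((q 1)^2)⁻¹, 0, 0;
       0, 0, -(1 / a) * q 0, 0;
       0, 0, 0, -(1 / a) * q 0 * (Real.sin (q 2))^2]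
  | 1 =>
    !![-(2 * b / a) * q 1, 2 * b / a * q 0, 0, 0;
       2 * b / a * q 0, -(2 * b / a) * (q 0)^2 * (q 1)⁻¹, 0, 0;
       0, 0, -(1 / a) * q 1, 0;
       0, 0, 0, -(1 / a) * q 1 * (Real.sin (q 2))^2]
  | 2 =>
    !![0, 0, 0, 0;
       0, 0, (q 1)⁻¹, 0;
       0, (q 1)⁻¹, 0, 0;
       0, 0, 0, -(Real.sin (q 2) * Real.cos (q 2))]
  | 3 =>
    !![0, 0, 0, 0;
       0, 0, 0, (q 1)⁻¹;
       0, 0, 0, Real.cos (q 2) / Real.sin (q 2);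
       0, (q 1)⁻¹, Real.cos (q 2) / Real.sin (q 2), 0]

/-- Closed form of the derivatives of the metric. -/
noncomputable def DG (b : ℝ) (l : Fin 4) (q : Fin 4 → ℝ) : Matrix (Fin 4) (Fin 4) ℝ :=
  match l with
  | 0 =>
    !![0, -(b * q 1), 0, 0; -(b * q 1), 2 * b * q 0, 0, 0; 0, 0, 0, 0; 0, 0, 0, 0]
  | 1 =>
    !![2 * b * q 1, -(b * q 0), 0, 0; -(b * q 0), 0, 0, 0;
        0, 0, 2 * q 1, 0; 0, 0, 0, 2 * q 1 * (Real.sin (q 2))^2]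
  | 2 =>
    !![0, 0, 0, 0; 0, 0, 0, 0; 0, 0, 0, 0;
        0, 0, 0, (q 1)^2 * (2 * Real.sin (q 2) * Real.cos (q 2))]
  | 3 =>
    0

lemma deriv_sin_sq (x : ℝ) :
    deriv (fun s => (Real.sin s)^2) x = 2 * Real.sin x * Real.cos x := by
  simp

lemma deriv_sq (x : ℝ) : deriv (fun s : ℝ => s^2) x = 2 * x := by
  simp

lemma deriv_cube (x : ℝ) (c : ℝ) :
    deriv (fun s : ℝ => c * s^3 - 2 * s) x = 3 * c * x^2 - 2 := by
  have h := ((((hasDerivAt_id x).pow 3).const_mul c).sub ((hasDerivAt_id x).const_mul 2)).deriv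
  have e : (fun s : ℝ => c * s^3 - 2 * s) = 
    ((fun y => c * (id ^ 3) y) - fun y => 2 * id y : ℝ → ℝ) := by
    ext s; simp
  rw [e, h]; simp; ring

lemma deriv_inv_sq (x : ℝ) (hx : x ≠ 0) :
    deriv (fun s : ℝ => (s^2)⁻¹) x = -2 * (x^3)⁻¹ := by
  have h : HasDerivAt (fun s : ℝ => s^2) (2 * x) x := by simpa using hasDerivAt_pow 2 x
  rw [(h.fun_inv (pow_ne_zero 2 hx)).deriv]; field_simp

lemma deriv_sin_cos (x : ℝ) :
    deriv (fun s => Real.sin s * Real.cos s) x = (Real.cos x)^2 - (Real.sin x)^2 := by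
  rw [((Real.hasDerivAt_sin x).fun_mul (Real.hasDerivAt_cos x)).deriv]; ring

lemma deriv_cot' (x : ℝ) (hx : Real.sin x ≠ 0) :
    deriv (fun s => Real.cos s / Real.sin s) x = - 1 / (Real.sin x)^2 := by
  rw [((Real.hasDerivAt_cos x).fun_div (Real.hasDerivAt_sin x) hx).deriv]
  congr 1; linear_combination - Real.sin_sq_add_cos_sq x

lemma pd_gmet (a b : ℝ) (m j k : Fin 4) (q : Fin 4 → ℝ) :
    pd m (fun q => gmet a b q j k) q = DG b m q j k := by
  (revert m; apply forall4) <;> (revert j; apply forall4) <;> (revert k; apply forall4) <;>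
    simp [pd, gmet, DG, Function.update_apply, deriv_sin_sq, deriv_sq] <;> ring

set_option maxHeartbeats 4000000 in
lemma Gamma_eq (a b : ℝ) (ha : a ≠ 0) (hb : b ≠ 0) (l j k : Fin 4) (q : Fin 4 → ℝ)
    (h1 : q 1 ≠ 0) (h2 : Real.sin (q 2) ≠ 0) : Gamma a b l j k q = GV a b l q j k := by
  simp only [_root_.Gamma, pd_gmet]
  (revert l; apply forall4) <;> (revert j; apply forall4) <;> (revert k; apply forall4) <;>
    simp [ginv, DG, GV, Fin.sum_univ_four] <;> field_simp <;> ring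

lemma pd_congr (k : Fin 4) (f g : (Fin 4 → ℝ) → ℝ) (p : Fin 4 → ℝ)
    (h1 : p 1 ≠ 0) (h2 : Real.sin (p 2) ≠ 0)
    (h : ∀ q, q 1 ≠ 0 → Real.sin (q 2) ≠ 0 → f q = g q) : pd k f p = pd k g p := by
  unfold pd
  apply Filter.EventuallyEq.deriv_eq
  have hc : Continuous (fun s => Function.update p k s) := continuous_const.update k continuous_id
  have c1 : ContinuousAt (fun s => Function.update p k s 1) (p k) :=
    ((continuous_apply 1).comp hc).continuousAt
  have c2 : ContinuousAt (fun s => Real.sin (Function.update p k s 2)) (p k) :=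
    (Real.continuous_sin.comp ((continuous_apply 2).comp hc)).continuousAt
  filter_upwards [c1.eventually_ne (by simpa using h1), c2.eventually_ne (by simpa using h2)]
    with s e1 e2
  exact h _ e1 e2

/-- Closed form of the derivatives of the Christoffel symbols. -/
noncomputable def DGV (a b : ℝ) (m l : Fin 4) (q : Fin 4 → ℝ) : Matrix (Fin 4) (Fin 4) ℝ :=
  match m, l with
  | 0, 0 =>
    !![-(2 * b / a), 4 * b / a * q 0 * (q 1)⁻¹, 0, 0;
         4 * b / a * q 0 * (q 1)⁻¹, (-(6 * b / a) * (q 0)^2 - 2) * ((q 1)^2)⁻¹, 0, 0;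
         0, 0, -(1 / a), 0;
         0, 0, 0, -(1 / a) * (Real.sin (q 2))^2]
  | 0, 1 =>
    !![0, 2 * b / a, 0, 0;
         2 * b / a, -(4 * b / a) * q 0 * (q 1)⁻¹, 0, 0;
         0, 0, 0, 0;
         0, 0, 0, 0]
  | 1, 0 =>
    !![0, -((2 * b / a * (q 0)^2 + 1) * ((q 1)^2)⁻¹), 0, 0;
         -((2 * b / a * (q 0)^2 + 1) * ((q 1)^2)⁻¹),
            (-(2 * b / a) * (q 0)^3 - 2 * q 0) * (-2 * ((q 1)^3)⁻¹), 0, 0;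
         0, 0, 0, 0;
         0, 0, 0, 0]
  | 1, 1 =>
    !![-(2 * b / a), 0, 0, 0;
         0, 2 * b / a * (q 0)^2 * ((q 1)^2)⁻¹, 0, 0;
         0, 0, -(1 / a), 0;
         0, 0, 0, -(1 / a) * (Real.sin (q 2))^2]
  | 1, 2 =>
    !![0, 0, 0, 0;
         0, 0, -((q 1)^2)⁻¹, 0;
         0, -((q 1)^2)⁻¹, 0, 0;
         0, 0, 0, 0]
  | 1, 3 =>
    !![0, 0, 0, 0;
         0, 0, 0, -((q 1)^2)⁻¹;
         0, 0, 0, 0;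
         0, -((q 1)^2)⁻¹, 0, 0]
  | 2, 0 =>
    !![0, 0, 0, 0; 0, 0, 0, 0; 0, 0, 0, 0;
         0, 0, 0, -(1 / a) * q 0 * (2 * Real.sin (q 2) * Real.cos (q 2))]
  | 2, 1 =>
    !![0, 0, 0, 0; 0, 0, 0, 0; 0, 0, 0, 0;
         0, 0, 0, -(1 / a) * q 1 * (2 * Real.sin (q 2) * Real.cos (q 2))]
  | 2, 2 =>
    !![0, 0, 0, 0; 0, 0, 0, 0; 0, 0, 0, 0;
         0, 0, 0, (Real.sin (q 2))^2 - (Real.cos (q 2))^2]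
  | 2, 3 =>
    !![0, 0, 0, 0; 0, 0, 0, 0;
         0, 0, 0, -1 / (Real.sin (q 2))^2;
         0, 0, -1 / (Real.sin (q 2))^2, 0]
  | _, _ => 0

set_option maxHeartbeats 4000000 in
lemma pd_GV (a b : ℝ) (m l j k : Fin 4) (q : Fin 4 → ℝ)
    (h1 : q 1 ≠ 0) (h2 : Real.sin (q 2) ≠ 0) :
    pd m (fun q => GV a b l q j k) q = DGV a b m l q j k := by
  have d3 := deriv_cube (q 0) (-(2 * b / a))
  simp only [neg_mul] at d3
  (revert m; apply forall4) <;> (revert l; apply forall4) <;> (revert j; apply forall4) <;> (revert k; apply forall4) <;>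
    simp [pd, GV, DGV, Function.update_apply, deriv_sin_sq, deriv_sq, d3,
      deriv_inv_sq _ h1, deriv_sin_cos, deriv_cot' _ h2] <;> ring_nf <;> simp

set_option maxHeartbeats 4000000 in
lemma Ricci_eq (a b : ℝ) (ha : a ≠ 0) (hb : b ≠ 0) (p : Fin 4 → ℝ)
    (h1 : p 1 ≠ 0) (h2 : Real.sin (p 2) ≠ 0) (i j : Fin 4) :
    RicciT a b i j p = RicciVal a b p i j := by
  have hG : ∀ l j k, Gamma a b l j k p = GV a b l p j k := fun l j k =>
    Gamma_eq a b ha hb l j k p h1 h2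
  have hD : ∀ m l j k, pd m (fun q => Gamma a b l j k q) p = DGV a b m l p j k := by
    intro m l j k
    rw [← pd_GV a b m l j k p h1 h2]
    exact pd_congr m _ _ p h1 h2 fun q e1 e2 => Gamma_eq a b ha hb l j k q e1 e2
  have hs := Real.sin_sq_add_cos_sq (p 2)
  have hc : (Real.cos (p 2))^2 = 1 - (Real.sin (p 2))^2 := by linarith
  simp only [RicciT, hG, hD]
  (revert i; apply forall4) <;> (revert j; apply forall4) <;>
    simp [GV, DGV, RicciVal, Fin.sum_univ_four] <;> field_simp <;> ring_nf <;>
    (try simp only [hc]) <;> ring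

/-- The Ricci tensor and scalar curvature of the metric `g` on `U` are as stated;
in particular `S = 0` identically when `a = 7`. -/
theorem stmt_6 (a b : ℝ) (ha : a ≠ 0) (hb : b ≠ 0) (p : Fin 4 → ℝ) (hp : p ∈ chartU) :
    (∀ i j, RicciT a b i j p = RicciVal a b p i j) ∧
    ScalC a b p = 2 * (a - 7) / (a * (p 1)^2) ∧
    (a = 7 → ScalC a b p = 0) := by
  have h1 : p 1 ≠ 0 := hp.1.ne'
  have h2 : Real.sin (p 2) ≠ 0 := (Real.sin_pos_of_pos_of_lt_pi hp.2.1 hp.2.2).ne'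
  have hR := Ricci_eq a b ha hb p h1 h2
  have hS : ScalC a b p = 2 * (a - 7) / (a * (p 1)^2) := by
    simp only [ScalC, hR]
    simp [ginv, RicciVal, Fin.sum_univ_four]
    field_simp
    ring
  refine ⟨hR, hS, ?_⟩
  intro h7
  rw [hS, h7]
  norm_num
end

section
/- On {(t, r) ∈ ℝ² : r > 0}, with b ∈ ℝ, b ≠ 0, the 2×2 metric g = [[b r², −b r t], [−b r t, 1 + b t²]] (coordinates ordered (t, r)) has Ricci tensor R_{ij} = −(2/r²)·g_{ij} at every point, where R_{ij} = ∂_k Γ^k_{ij} − ∂_j Γ^k_{ik} + Γ^k_{kl} Γ^l_{ij} − Γ^k_{jl} Γ^l_{ik} and Γ are the Christoffel symbols of g. In particular the Ricci tensor is proportional to g with factor singular along r = 0, and the scalar curvature equals −4/r²; this 2D metric is never flat. -/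
/-- The 2D metric matrix `g = [[b r², −b r t], [−b r t, 1 + b t²]]` in coordinates
`(t, r) = (p 0, p 1)` on the half-plane `r > 0`. -/
noncomputable def gmet2 (b : ℝ) (p : Fin 2 → ℝ) : Matrix (Fin 2) (Fin 2) ℝ :=
  !![b * (p 1)^2, -(b * (p 1) * (p 0));
     -(b * (p 1) * (p 0)), 1 + b * (p 0)^2]

/-- The inverse metric matrix. -/
noncomputable def ginv2 (b : ℝ) (p : Fin 2 → ℝ) : Matrix (Fin 2) (Fin 2) ℝ :=
  !![(1 + b * (p 0)^2) / (b * (p 1)^2), (p 0) / (p 1);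
     (p 0) / (p 1), 1]

/-- Partial derivative `∂_j f` of a function of the coordinates. -/
noncomputable def pd2 (j : Fin 2) (f : (Fin 2 → ℝ) → ℝ) (p : Fin 2 → ℝ) : ℝ :=
  deriv (fun s => f (Function.update p j s)) (p j)

/-- Christoffel symbols `Γ^l_{jk} = ½ Σ_m (g⁻¹)^{lm}(∂_j g_{mk} + ∂_k g_{jm} − ∂_m g_{jk})`. -/
noncomputable def Gamma2 (b : ℝ) (l j k : Fin 2) (p : Fin 2 → ℝ) : ℝ :=
  (1/2) * ∑ m, ginv2 b p l m *
    (pd2 j (fun q => gmet2 b q m k) p + pd2 k (fun q => gmet2 b q j m) p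
      - pd2 m (fun q => gmet2 b q j k) p)

/-- The Ricci tensor
`R_{ij} = ∂_k Γ^k_{ij} − ∂_j Γ^k_{ik} + Γ^k_{kl} Γ^l_{ij} − Γ^k_{jl} Γ^l_{ik}`. -/
noncomputable def RicciT2 (b : ℝ) (i j : Fin 2) (p : Fin 2 → ℝ) : ℝ :=
  (∑ k, pd2 k (fun q => Gamma2 b k i j q) p)
    - (∑ k, pd2 j (fun q => Gamma2 b k i k q) p)
    + (∑ k, ∑ l, Gamma2 b k k l p * Gamma2 b l i j p)
    - (∑ k, ∑ l, Gamma2 b k j l p * Gamma2 b l i k p)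

/-- The scalar curvature `S = Σ_{ij} (g⁻¹)^{ij} R_{ij}`. -/
noncomputable def ScalC2 (b : ℝ) (p : Fin 2 → ℝ) : ℝ :=
  ∑ i, ∑ j, ginv2 b p i j * RicciT2 b i j p


theorem pd2_zero_of {f : (Fin 2 → ℝ) → ℝ} {p : Fin 2 → ℝ} {F : ℝ → ℝ → ℝ} {d : ℝ}
    (hp : p 1 ≠ 0) (hf : ∀ q : Fin 2 → ℝ, q 1 ≠ 0 → f q = F (q 0) (q 1))
    (hd : HasDerivAt (fun s => F s (p 1)) d (p 0)) : pd2 0 f p = d := by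
  unfold pd2
  have : (fun s => f (Function.update p 0 s)) = fun s => F s (p 1) := by
    funext s
    rw [hf _ (by simpa using hp)]
    simp
  rw [this]
  exact hd.deriv

theorem pd2_one_of {f : (Fin 2 → ℝ) → ℝ} {p : Fin 2 → ℝ} {F : ℝ → ℝ → ℝ} {d : ℝ}
    (hp : p 1 ≠ 0) (hf : ∀ q : Fin 2 → ℝ, q 1 ≠ 0 → f q = F (q 0) (q 1))
    (hd : HasDerivAt (fun s => F (p 0) s) d (p 1)) : pd2 1 f p = d := by
  unfold pd2
  have : (fun s => f (Function.update p 1 s)) =ᶠ[nhds (p 1)] fun s => F (p 0) s := by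
    filter_upwards [isOpen_ne.mem_nhds hp] with s hs
    rw [hf _ (by simpa using hs)]
    simp
  rw [this.deriv_eq]
  exact hd.deriv

theorem gmet2_d (b : ℝ) (p : Fin 2 → ℝ) (j m k : Fin 2) :
    pd2 j (fun q => gmet2 b q m k) p =
      (![!![0, -(b * p 1); -(b * p 1), 2 * b * p 0],
         !![2 * b * p 1, -(b * p 0); -(b * p 0), 0]] : Fin 2 → Matrix (Fin 2) (Fin 2) ℝ) j m k := by
  fin_cases j <;> fin_cases m <;> fin_cases k <;> simp [pd2, gmet2] <;> ring

/-- closed forms of the Christoffel symbols -/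
noncomputable def GamF (b : ℝ) (l j k : Fin 2) (t r : ℝ) : ℝ :=
  (![!![-(2 * b * t), (1 + 2 * b * t ^ 2) / r; (1 + 2 * b * t ^ 2) / r,
        -(2 * t * (1 + b * t ^ 2)) / r ^ 2],
     !![-(2 * b * r), 2 * b * t; 2 * b * t, -(2 * b * t ^ 2) / r]] :
      Fin 2 → Matrix (Fin 2) (Fin 2) ℝ) l j k

theorem Gamma2_eq (b : ℝ) (hb : b ≠ 0) (l j k : Fin 2) (p : Fin 2 → ℝ) (hp : p 1 ≠ 0) :
    Gamma2 b l j k p = GamF b l j k (p 0) (p 1) := by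
  unfold Gamma2 GamF
  simp only [gmet2_d, Fin.sum_univ_two, ginv2]
  fin_cases l <;> fin_cases j <;> fin_cases k <;> simp <;> field_simp <;> ring

/-- `t`-derivatives of the Christoffel symbols -/
noncomputable def GamT (b : ℝ) (l j k : Fin 2) (t r : ℝ) : ℝ :=
  (![!![-(2 * b), (4 * b * t) / r; (4 * b * t) / r, -(2 + 6 * b * t ^ 2) / r ^ 2],
     !![0, 2 * b; 2 * b, -(4 * b * t) / r]] :
      Fin 2 → Matrix (Fin 2) (Fin 2) ℝ) l j k

/-- `r`-derivatives of the Christoffel symbols -/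
noncomputable def GamR (b : ℝ) (l j k : Fin 2) (t r : ℝ) : ℝ :=
  (![!![0, -(1 + 2 * b * t ^ 2) / r ^ 2; -(1 + 2 * b * t ^ 2) / r ^ 2,
        (4 * t * (1 + b * t ^ 2)) / r ^ 3],
     !![-(2 * b), 0; 0, (2 * b * t ^ 2) / r ^ 2]] :
      Fin 2 → Matrix (Fin 2) (Fin 2) ℝ) l j k

theorem hd_poly (c₀ c₁ c₂ c₃ t : ℝ) : HasDerivAt (fun s : ℝ => c₀ + c₁ * s + c₂ * s ^ 2 + c₃ * s ^ 3)
    (c₁ + 2 * c₂ * t + 3 * c₃ * t ^ 2) t := by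
  have h1 := (hasDerivAt_id' t).const_mul c₁
  have h2 := (hasDerivAt_pow 2 t).const_mul c₂
  have h3 := (hasDerivAt_pow 3 t).const_mul c₃
  refine ((((hasDerivAt_const t c₀).add h1).add h2).add h3).congr_deriv ?_
  push_cast
  ring

theorem hd_laurent (c₀ c₁ d₁ d₂ r : ℝ) (hr : r ≠ 0) :
    HasDerivAt (fun s : ℝ => c₀ + c₁ * s + d₁ * s⁻¹ + d₂ * (s ^ 2)⁻¹)
    (c₁ - d₁ / r ^ 2 - 2 * d₂ / r ^ 3) r := by
  have h1 := (hasDerivAt_id' r).const_mul c₁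
  have h2 := (hasDerivAt_inv hr).const_mul d₁
  have h3 := ((hasDerivAt_pow 2 r).inv (pow_ne_zero 2 hr)).const_mul d₂
  refine ((((hasDerivAt_const r c₀).add h1).add h2).add h3).congr_deriv ?_
  push_cast
  field_simp
  ring

theorem GamF_t (b : ℝ) (l j k : Fin 2) (t r : ℝ) (hr : r ≠ 0) :
    HasDerivAt (fun s => GamF b l j k s r) (GamT b l j k t r) t := by
  fin_cases l <;> fin_cases j <;> fin_cases k <;> simp [GamF, GamT]
  · convert hd_poly 0 (-(2 * b)) 0 0 t using 1 <;> [(funext s; ring); ring]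
  · convert hd_poly (1 / r) 0 (2 * b / r) 0 t using 1 <;> [(funext s; ring); ring]
  · convert hd_poly (1 / r) 0 (2 * b / r) 0 t using 1 <;> [(funext s; ring); ring]
  · convert hd_poly 0 (-2 / r ^ 2) 0 (-(2 * b) / r ^ 2) t using 1 <;> [(funext s; ring); ring]
  · exact hasDerivAt_const _ _
  · convert hd_poly 0 (2 * b) 0 0 t using 1 <;> [(funext s; ring); ring]
  · convert hd_poly 0 (2 * b) 0 0 t using 1 <;> [(funext s; ring); ring]
  · convert hd_poly 0 0 (-(2 * b) / r) 0 t using 1 <;> [(funext s; ring); ring]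

theorem GamF_r (b : ℝ) (l j k : Fin 2) (t r : ℝ) (hr : r ≠ 0) :
    HasDerivAt (fun s => GamF b l j k t s) (GamR b l j k t r) r := by
  fin_cases l <;> fin_cases j <;> fin_cases k <;> simp [GamF, GamR]
  · exact hasDerivAt_const _ _
  · convert hd_laurent 0 0 (1 + 2 * b * t ^ 2) 0 r hr using 1 <;> [(funext s; ring); ring]
  · convert hd_laurent 0 0 (1 + 2 * b * t ^ 2) 0 r hr using 1 <;> [(funext s; ring); ring]
  · convert hd_laurent 0 0 0 (-(2 * t * (1 + b * t ^ 2))) r hr using 1 <;>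
      [(funext s; ring); ring]
  · convert hd_laurent 0 (-(2 * b)) 0 0 r hr using 1 <;> [(funext s; ring); ring]
  · exact hasDerivAt_const _ _
  · exact hasDerivAt_const _ _
  · convert hd_laurent 0 0 (-(2 * b * t ^ 2)) 0 r hr using 1 <;> [(funext s; ring); ring]

theorem Ricci_eq_s11 (b : ℝ) (hb : b ≠ 0) (p : Fin 2 → ℝ) (hp : p 1 ≠ 0) (i j : Fin 2) :
    RicciT2 b i j p = -(2 / (p 1)^2) * gmet2 b p i j := by
  have h0 : ∀ l j k, pd2 0 (fun q => Gamma2 b l j k q) p = GamT b l j k (p 0) (p 1) :=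
    fun l j k => pd2_zero_of hp (fun q hq => Gamma2_eq b hb l j k q hq) (GamF_t b l j k _ _ hp)
  have h1 : ∀ l j k, pd2 1 (fun q => Gamma2 b l j k q) p = GamR b l j k (p 0) (p 1) :=
    fun l j k => pd2_one_of hp (fun q hq => Gamma2_eq b hb l j k q hq) (GamF_r b l j k _ _ hp)
  have hG : ∀ l j k, Gamma2 b l j k p = GamF b l j k (p 0) (p 1) :=
    fun l j k => Gamma2_eq b hb l j k p hp
  fin_cases i <;> fin_cases j <;>
    simp only [RicciT2, Fin.sum_univ_two, Fin.zero_eta, Fin.mk_one, h0, h1, hG] <;>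
    simp [GamF, GamT, GamR, gmet2] <;> field_simp <;> ring

/-- The classical limit of the central quantum metric of the 2D bicrossproduct model
has `R_{ij} = −(2/r²) g_{ij}` and scalar curvature `−4/r²`; in particular the Ricci
tensor is proportional to `g` with factor singular along `r = 0`, and the metric is
never flat. -/
theorem stmt_11 (b : ℝ) (hb : b ≠ 0) (p : Fin 2 → ℝ) (hp : 0 < p 1) :
    (∀ i j, RicciT2 b i j p = -(2 / (p 1)^2) * gmet2 b p i j) ∧
    ScalC2 b p = -(4 / (p 1)^2) ∧ ScalC2 b p ≠ 0 := by
  have hr : p 1 ≠ 0 := hp.ne'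
  have hS : ScalC2 b p = -(4 / (p 1)^2) := by
    simp only [ScalC2, Fin.sum_univ_two, Ricci_eq_s11 b hb p hr]
    simp [ginv2, gmet2]
    field_simp
    ring
  refine ⟨fun i j => Ricci_eq_s11 b hb p hr i j, hS, ?_⟩
  rw [hS]
  exact neg_ne_zero.mpr (by positivity)
end

section
/- Fix b ∈ ℝ with b ≠ 0 and λ ∈ ℂ purely imaginary with λ ≠ 0, 1 + bλ² ≠ 0 and 4 + 7bλ² ≠ 0. A 'real' octuple (α, β, γ, δ, α′, β′, γ′, δ′) with α ≠ 0 satisfies the *-preservation equations (E1)–(E8), the metric-compatibility equations (M1)–(M6), and the zero-torsion condition γ = λα + β, if and only if it is one of exactly two octuples: (i) the quantum Levi-Civita connection with classical limit, with α = 8b/(4 + 7bλ²), β = −12bλ/(4 + 7bλ²), γ = −4bλ/(4 + 7bλ²), δ = 6bλ²/(4 + 7bλ²) and primed coefficients given by (F1)–(F4); or (ii) the nonperturbative quantum Levi-Civita connection, with α = b/(1 + bλ²), β = −2/λ, γ = −(2 + bλ²)/(λ(1 + bλ²)), δ = 3(2 + bλ²)/(2(1 + bλ²)) and primed coefficients given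 by (F1)–(F4). -/
/-- The *-preservation equations (E1)–(E8). -/
def StarEqs (lam α β γ δ α' β' γ' δ' : ℂ) : Prop :=
  (α - star α = lam * (star α * α' + α * star β) - lam^2 * (α * star α)) ∧
  (β - star β = lam * (β * star β + star α * (β' - 1)) - lam^2 * (star α * β)) ∧
  (γ - star γ = lam * (star β * γ + star α * (γ' - 1)) - lam^2 * (star α * γ)) ∧
  (δ - star δ = lam * (star α * δ' + star β * (δ - 1) - star γ) - lam^2 * (star α * (δ - 1))) ∧
  (α' - star α' = lam * (α * (star β' + 1) + α' * star α') - lam^2 * (star α' * α)) ∧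
  (β' - star β' = lam * (β * (star β' + 1) + star α' * (β' - 1)) - lam^2 * (star α' * β)) ∧
  (γ' - star γ' = lam * (γ * (star β' + 1) + star α' * (γ' - 1)) - lam^2 * (star α' * γ)) ∧
  (δ' - star δ' = lam * (star α' * δ' + (star β' + 1) * (δ - 1) - (star γ' - 1))
      - lam^2 * (star α' * (δ - 1)))


/-- The metric-compatibility equations (M1)–(M6) for the quantum metric
`g = dr⊗dr + b(v*⊗v + λ(dr⊗v − v*⊗dr))`. -/
def MetricEqs (b : ℝ) (lam α β γ δ α' β' γ' δ' : ℂ) : Prop :=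
  (α' + star α' = lam * (α - star α)) ∧
  (β + star β = -(b * lam * (β' - star β'))) ∧
  (α + lam * b * star β = -(b * (star β' + lam * α'))) ∧
  (γ' + star γ' = lam * (γ - star γ + star α' + lam * star α)) ∧
  (δ + star δ + b * lam * (δ' - star δ') = lam * (star β - lam * b * star β')) ∧
  (γ + lam * b * γ' + b * (star δ' + lam * star δ) = lam * b * (star β' + lam * star β))


/-- The primed-coefficient formulas (F1)–(F4). -/
def PrimedFormulas (lam α β γ δ α' β' γ' δ' : ℂ) : Prop :=
  (α' = (α - star α - lam * star β * α + lam^2 * (α * star α)) / (lam * star α)) ∧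
  (β' = (β - star β + lam * (star α - β * star β) + lam^2 * (star α * β)) / (lam * star α)) ∧
  (γ' = (γ - star γ + lam * (star α - star β * γ) + lam^2 * (star α * γ)) / (lam * star α)) ∧
  (δ' = (δ - star δ + lam * (star γ - star β * (δ - 1)) + lam^2 * (star α * (δ - 1)))
      / (lam * star α))


/-- 'Real' octuple: `α, δ, β′, γ′` real and `β, γ, α′, δ′` purely imaginary. -/
def RealOctuple (α β γ δ α' β' γ' δ' : ℂ) : Prop :=
  α.im = 0 ∧ δ.im = 0 ∧ β'.im = 0 ∧ γ'.im = 0 ∧ β.re = 0 ∧ γ.re = 0 ∧ α'.re = 0 ∧ δ'.re = 0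

theorem star_of_im_zero {z : ℂ} (h : z.im = 0) : star z = z := by
  apply Complex.ext <;> simp [h]

theorem star_of_re_zero {z : ℂ} (h : z.re = 0) : star z = -z := by
  apply Complex.ext <;> simp [h]

/-- Quantum Levi-Civita connections of the 2D bicrossproduct model: a 'real' octuple
with `α ≠ 0` satisfies *-preservation, metric compatibility and zero torsion
`γ = λα + β` iff it is (i) the quantum Levi-Civita connection with classical limit,
or (ii) the nonperturbative one, with unprimed coefficients as stated and primed
coefficients given by (F1)–(F4). -/
theorem stmt_15 (b : ℝ) (hb : b ≠ 0) (lam : ℂ) (hlam : lam ≠ 0) (hlam_im : lam.re = 0)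
    (hb_lam : 1 + (b : ℂ) * lam^2 ≠ 0) (hb_lam7 : 4 + 7 * (b : ℂ) * lam^2 ≠ 0)
    (α β γ δ α' β' γ' δ' : ℂ) (hα : α ≠ 0)
    (hreal : RealOctuple α β γ δ α' β' γ' δ') :
    (StarEqs lam α β γ δ α' β' γ' δ' ∧ MetricEqs b lam α β γ δ α' β' γ' δ' ∧
        γ = lam * α + β)
    ↔ ((α = 8 * (b : ℂ) / (4 + 7 * (b : ℂ) * lam^2) ∧
          β = -(12 * (b : ℂ) * lam / (4 + 7 * (b : ℂ) * lam^2)) ∧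
          γ = -(4 * (b : ℂ) * lam / (4 + 7 * (b : ℂ) * lam^2)) ∧
          δ = 6 * (b : ℂ) * lam^2 / (4 + 7 * (b : ℂ) * lam^2) ∧
          PrimedFormulas lam α β γ δ α' β' γ' δ')
      ∨ (α = (b : ℂ) / (1 + (b : ℂ) * lam^2) ∧
          β = -(2 / lam) ∧
          γ = -((2 + (b : ℂ) * lam^2) / (lam * (1 + (b : ℂ) * lam^2))) ∧
          δ = 3 * (2 + (b : ℂ) * lam^2) / (2 * (1 + (b : ℂ) * lam^2)) ∧
          PrimedFormulas lam α β γ δ α' β' γ' δ')) := by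
  obtain ⟨h1, h2, h3, h4, h5, h6, h7, h8⟩ := hreal
  have hbc : (b : ℂ) ≠ 0 := by exact_mod_cast hb
  unfold StarEqs MetricEqs PrimedFormulas
  generalize (b : ℂ) = B at *
  have n1 : 1 + lam^2 * B ≠ 0 := by rwa [mul_comm]
  have n2 : 4 + B * 7 * lam^2 ≠ 0 := by rwa [mul_comm B 7]
  have n3 : 4 + lam^2 * B * 7 ≠ 0 := by
    intro h; apply hb_lam7; linear_combination h
  have n4 : 4 + lam^2 * 7 * B ≠ 0 := by
    intro h; apply hb_lam7; linear_combination h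
  have n5 : 4 + 7 * lam^2 * B ≠ 0 := by
    intro h; apply hb_lam7; linear_combination h
  have n6 : 4 + B * lam^2 * 7 ≠ 0 := by
    intro h; apply hb_lam7; linear_combination h
  rw [star_of_im_zero h1, star_of_im_zero h2, star_of_im_zero h3, star_of_im_zero h4,
    star_of_re_zero h5, star_of_re_zero h6, star_of_re_zero h7, star_of_re_zero h8]
  clear h1 h2 h3 h4 h5 h6 h7 h8
  constructor
  · rintro ⟨⟨e1, e2, e3, e4, e5, e6, e7, e8⟩, ⟨m1, m2, m3, m4, m5, m6⟩, ht⟩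
    have F : (α' = (α - α - lam * -β * α + lam^2 * (α * α)) / (lam * α)) ∧
        (β' = (β - -β + lam * (α - β * -β) + lam^2 * (α * β)) / (lam * α)) ∧
        (γ' = (γ - -γ + lam * (α - -β * γ) + lam^2 * (α * γ)) / (lam * α)) ∧
        (δ' = (δ - δ + lam * (-γ - -β * (δ - 1)) + lam^2 * (α * (δ - 1))) / (lam * α)) := by
      have hne : lam * α ≠ 0 := mul_ne_zero hlam hα
      refine ⟨?_, ?_, ?_, ?_⟩ <;> rw [eq_div_iff hne]
      · linear_combination -e1
      · linear_combination -e2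
      · linear_combination -e3
      · linear_combination -e4
    have ha' : α' = γ := by
      apply mul_left_cancel₀ (mul_ne_zero hlam hα)
      linear_combination -e1 - lam * α * ht
    have hb' : B * β' = -(α * (1 + B * lam^2)) := by
      subst ha' ht
      linear_combination m3
    have hg' : 2 * γ' = lam * (γ + lam * α) := by
      subst ha'
      linear_combination m4
    have hd' : α * δ' = γ * (δ - 2) := by
      apply mul_left_cancel₀ hlam
      subst ht
      linear_combination -e4
    have hprod : (lam * β + 2) * (2 * β + 3 * lam * α) = 0 := by
      subst ht
      linear_combination 2 * e3 + lam * α * hg'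
    have hE2 : B * (lam * β^2 + 2 * β + lam * α + lam^2 * α * β)
        + lam * α^2 * (1 + B * lam^2) = 0 := by
      linear_combination B * e2 + lam * α * hb'
    have hD : α * (γ + lam * B * γ' + B * lam * δ - lam * (-(α * (1 + B * lam^2)))
        + B * lam^2 * β) = B * (γ * (δ - 2)) := by
      linear_combination α * m6 + B * hd' + lam * α * hb'
    rcases mul_eq_zero.mp hprod with hx | hx
    · right
      have hβ : β = -(2 / lam) := by
        field_simp
        linear_combination hx
      have hαv : α = B / (1 + B * lam^2) := by
        rw [eq_div_iff hb_lam]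
        apply mul_left_cancel₀ (mul_ne_zero hlam hα)
        linear_combination hE2 - B * (β + lam * α) * hx
      have hγ : γ = -((2 + B * lam^2) / (lam * (1 + B * lam^2))) := by
        rw [ht, hβ, hαv]; field_simp; ring
      refine ⟨hαv, hβ, hγ, ?_, F⟩
      have hg2 : γ' = lam * (γ + lam * α) / 2 := by linear_combination hg' / 2
      rw [hg2, hγ, hβ, hαv] at hD
      field_simp at hD ⊢
      apply mul_left_cancel₀ hb_lam
      linear_combination hD / 2
    · left
      have hβ0 : β = -(3 * lam * α / 2) := by linear_combination hx / 2
      have hαv : α = 8 * B / (4 + 7 * B * lam^2) := by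
        rw [eq_div_iff hb_lam7]
        apply mul_left_cancel₀ (mul_ne_zero hlam hα)
        rw [hβ0] at hE2
        linear_combination 4 * hE2
      have hβ : β = -(12 * B * lam / (4 + 7 * B * lam^2)) := by
        rw [hβ0, hαv]; field_simp; ring
      have hγ : γ = -(4 * B * lam / (4 + 7 * B * lam^2)) := by
        rw [ht, hβ, hαv]; field_simp; ring
      refine ⟨hαv, hβ, hγ, ?_, F⟩
      have hg2 : γ' = lam * (γ + lam * α) / 2 := by linear_combination hg' / 2
      rw [hg2, hγ, hβ, hαv] at hD
      field_simp at hD ⊢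
      linear_combination hD / 24
  · rintro (⟨ha, hβ, hγ, hδ, f1, f2, f3, f4⟩ | ⟨ha, hβ, hγ, hδ, f1, f2, f3, f4⟩)
    · have g1 : α' = γ := by
        rw [f1, hγ, hβ, ha]; field_simp; ring
      have g2 : β' = -(8 * (1 + B * lam^2) / (4 + 7 * B * lam^2)) := by
        rw [f2, hβ, ha]; field_simp; ring
      have g3 : γ' = 2 * B * lam^2 / (4 + 7 * B * lam^2) := by
        rw [f3, hγ, hβ, ha]; field_simp; ring
      have g4 : δ' = lam * (4 + 4 * B * lam^2) / (4 + 7 * B * lam^2) := by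
        rw [f4, hγ, hβ, hδ, ha]; field_simp; ring
      rw [g1, g2, g3, g4, hγ, hβ, hδ, ha]
      refine ⟨⟨?_, ?_, ?_, ?_, ?_, ?_, ?_, ?_⟩, ⟨?_, ?_, ?_, ?_, ?_, ?_⟩, ?_⟩ <;>
        field_simp <;> ring
    · have g1 : α' = γ := by
        rw [f1, hγ, hβ, ha]; field_simp; ring
      have g2 : β' = -1 := by
        rw [f2, hβ, ha]; field_simp; ring
      have g3 : γ' = -(1 / (1 + B * lam^2)) := by
        rw [f3, hγ, hβ, ha]; field_simp; ring
      have g4 : δ' = (2 + B * lam^2) * (B * lam^2 - 2) / (2 * B * lam * (1 + B * lam^2)) := by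
        rw [f4, hγ, hβ, hδ, ha]; field_simp; ring
      rw [g1, g2, g3, g4, hγ, hβ, hδ, ha]
      refine ⟨⟨?_, ?_, ?_, ?_, ?_, ?_, ?_, ?_⟩, ⟨?_, ?_, ?_, ?_, ?_, ?_⟩, ?_⟩ <;>
        field_simp <;> ring
end
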